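/- arXiv:1708.01861 — 2 statements merged into one kernel-verified Lean document; each statement's English description precedes it below -/
import Mathlib

section
/- (Theorem 2, LNML density.) Fix integers m ≥ 1, n ≥ 1, reals ν > m−1, ρ² > 0, a vector μ₀ ∈ ℝ^m and a positive definite matrix Σ₀ ∈ ℝ^{m×m}. Define p̄_n(x^n) = sup_{μ∈ℝ^m, Σ≻0} f(x^n;μ,Σ)·π(μ,Σ;ν,μ₀,Σ₀,ρ²) / 𝒞(m,n,ν,|Σ₀|^{1/m},ρ²). Then for every x^n ∈ (ℝ^m)^n, p̄_n(x^n) = (ν^ν / (π^n·(n+ν)^{n+ν}·(1+n/(ρ²ν))))^{m/2} · (Γ_m((n+ν)/2)/Γ_m(ν/2)) · |Σ₀|^{ν/2}/|Σ̄_n|^{(n+ν)/2}, and ∫_{(ℝ^m)^n} p̄_n(x^n) dx^n = 1, where Σ̄_n = (1/(n+ν))·(Σ_{i=1}^n (x_i−μ₀)(x_i−μ₀)ᵀ + νΣ₀) − (1/((ν+n)(ρ²ν+n)))·Σ_{i,j=1}^n (x_i−μ₀)(x_j−μ₀)ᵀ. -/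
open MeasureTheory Matrix Real BigOperators

/-- Likelihood of `n` observations under the `m`-dimensional normal distribution
with mean `μ` and covariance `S`. -/
noncomputable def mvnLik (m n : ℕ) (x : Fin n → Fin m → ℝ) (μ : Fin m → ℝ)
    (S : Matrix (Fin m) (Fin m) ℝ) : ℝ :=
  ∏ i : Fin n, (2 * π) ^ (-(m : ℝ) / 2) * S.det ^ (-(1 : ℝ) / 2) *
    Real.exp (-(1 / 2) * ((x i - μ) ⬝ᵥ (S⁻¹ *ᵥ (x i - μ))))

/-- The simple luckiness function `π(μ, Σ; ν, σ², ρ²)`. -/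
noncomputable def luck (m : ℕ) (μ : Fin m → ℝ) (S : Matrix (Fin m) (Fin m) ℝ)
    (ν σ2 ρ2 : ℝ) : ℝ :=
  (2 * π) ^ (-(m : ℝ) * ν / 2) * S.det ^ (-ν / 2) *
    Real.exp (-(ν / 2) *
      (S⁻¹ * (σ2 • (1 : Matrix (Fin m) (Fin m) ℝ) + ρ2 • vecMulVec μ μ)).trace)

/-- The generalized luckiness function `π(μ, Σ; ν, μ₀, Σ₀, ρ²)`. -/
noncomputable def luck2 (m : ℕ) (μ : Fin m → ℝ) (S : Matrix (Fin m) (Fin m) ℝ)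
    (ν : ℝ) (μ0 : Fin m → ℝ) (S0 : Matrix (Fin m) (Fin m) ℝ) (ρ2 : ℝ) : ℝ :=
  (2 * π) ^ (-(m : ℝ) * ν / 2) * S.det ^ (-ν / 2) *
    Real.exp (-(ν / 2) *
      (S⁻¹ * (S0 + ρ2 • vecMulVec (μ - μ0) (μ - μ0))).trace)

/-- MAP location estimate `μ̄_k` for the simple luckiness. -/
noncomputable def muBar (m k : ℕ) (ν ρ2 : ℝ) (x : Fin k → Fin m → ℝ) : Fin m → ℝ :=
  (1 / (k + ρ2 * ν)) • ∑ i : Fin k, x i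

/-- MAP covariance estimate `Σ̄_k` for the simple luckiness. -/
noncomputable def sigmaBar (m k : ℕ) (ν σ2 ρ2 : ℝ) (x : Fin k → Fin m → ℝ) :
    Matrix (Fin m) (Fin m) ℝ :=
  (1 / (k + ν)) •
      (∑ i : Fin k, vecMulVec (x i) (x i) + (ν * σ2) • (1 : Matrix (Fin m) (Fin m) ℝ))
    - (1 / ((ν + k) * (ρ2 * ν + k))) • ∑ i : Fin k, ∑ j : Fin k, vecMulVec (x i) (x j)

/-- MAP location estimate `μ̄_k` for the generalized luckiness. -/
noncomputable def muBar2 (m k : ℕ) (ν ρ2 : ℝ) (μ0 : Fin m → ℝ)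
    (x : Fin k → Fin m → ℝ) : Fin m → ℝ :=
  μ0 + (1 / (k + ρ2 * ν)) • ∑ i : Fin k, (x i - μ0)

/-- MAP covariance estimate `Σ̄_k` for the generalized luckiness. -/
noncomputable def sigmaBar2 (m k : ℕ) (ν ρ2 : ℝ) (μ0 : Fin m → ℝ)
    (S0 : Matrix (Fin m) (Fin m) ℝ) (x : Fin k → Fin m → ℝ) : Matrix (Fin m) (Fin m) ℝ :=
  (1 / (k + ν)) • (∑ i : Fin k, vecMulVec (x i - μ0) (x i - μ0) + ν • S0)
    - (1 / ((ν + k) * (ρ2 * ν + k))) •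
        ∑ i : Fin k, ∑ j : Fin k, vecMulVec (x i - μ0) (x j - μ0)

/-- The multivariate gamma function `Γ_m(z)`. -/
noncomputable def multiGamma (m : ℕ) (z : ℝ) : ℝ :=
  π ^ ((m : ℝ) * ((m : ℝ) - 1) / 4) * ∏ j : Fin m, Real.Gamma (z - (j : ℝ) / 2)

/-- The capacity `𝒞(m, n, ν, σ², ρ²)` (note: the fourth argument is `σ²`,
so `σ^{-mν} = (σ²)^{-mν/2}`). -/
noncomputable def capC (m n : ℕ) (ν σ2 ρ2 : ℝ) : ℝ :=
  σ2 ^ (-(m : ℝ) * ν / 2) *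
    ((((n : ℝ) + ν) ^ ((n : ℝ) + ν) * (1 + n / (ρ2 * ν))) /
        ((2 * Real.exp 1) ^ ((n : ℝ) + ν) * (π * ν) ^ ν)) ^ ((m : ℝ) / 2) *
    (multiGamma m (ν / 2) / multiGamma m (((n : ℝ) + ν) / 2))

/-- The pointwise supremum of likelihood times simple luckiness over all `μ`
and positive definite `Σ`. -/
noncomputable def supLik (m n : ℕ) (ν σ2 ρ2 : ℝ) (x : Fin n → Fin m → ℝ) : ℝ :=
  ⨆ p : (Fin m → ℝ) × {S : Matrix (Fin m) (Fin m) ℝ // S.PosDef},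
    mvnLik m n x p.1 p.2.1 * luck m p.1 p.2.1 ν σ2 ρ2

/-- The pointwise supremum of likelihood times generalized luckiness over all `μ`
and positive definite `Σ`. -/
noncomputable def supLik2 (m n : ℕ) (ν : ℝ) (μ0 : Fin m → ℝ)
    (S0 : Matrix (Fin m) (Fin m) ℝ) (ρ2 : ℝ) (x : Fin n → Fin m → ℝ) : ℝ :=
  ⨆ p : (Fin m → ℝ) × {S : Matrix (Fin m) (Fin m) ℝ // S.PosDef},
    mvnLik m n x p.1 p.2.1 * luck2 m p.1 p.2.1 ν μ0 S0 ρ2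

/-- The density of the `m`-variate Student t-distribution with `d` degrees of
freedom, location `μ` and scale matrix `S`. -/
noncomputable def tDens (m : ℕ) (d : ℝ) (x μ : Fin m → ℝ)
    (S : Matrix (Fin m) (Fin m) ℝ) : ℝ :=
  Real.Gamma ((d + m) / 2) /
      (Real.Gamma (d / 2) * (d * π) ^ ((m : ℝ) / 2) * S.det ^ ((1 : ℝ) / 2)) *
    (1 + (1 / d) * ((x - μ) ⬝ᵥ (S⁻¹ *ᵥ (x - μ)))) ^ (-(d + (m : ℝ)) / 2)

theorem lintegral_rpow_mul_exp_neg_mul_Ioi {a r : ℝ} (ha : 0 < a) (hr : 0 < r) :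
    ∫⁻ t in Set.Ioi (0 : ℝ), ENNReal.ofReal (t ^ (a - 1) * Real.exp (-(r * t))) =
      ENNReal.ofReal (r ^ (-a) * Real.Gamma a) := by
  have h := Real.integral_rpow_mul_exp_neg_mul_Ioi ha hr
  have hpos : 0 < (1 / r) ^ a * Real.Gamma a :=
    mul_pos (Real.rpow_pos_of_pos (by positivity) _) (Real.Gamma_pos_of_pos ha)
  rw [← ofReal_integral_eq_lintegral_ofReal
    (Integrable.of_integral_ne_zero (by rw [h]; exact hpos.ne')), h, one_div,
    Real.inv_rpow hr.le, Real.rpow_neg hr.le]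
  filter_upwards [ae_restrict_mem measurableSet_Ioi] with t ht
  exact mul_nonneg (Real.rpow_nonneg (le_of_lt ht) _) (Real.exp_pos _).le

theorem lintegral_exp_neg_mul_dotProduct_self (m : ℕ) {b : ℝ} (hb : 0 < b) :
    ∫⁻ u : Fin m → ℝ, ENNReal.ofReal (Real.exp (-b * (u ⬝ᵥ u))) =
      ENNReal.ofReal ((π / b) ^ ((m : ℝ) / 2)) := by
  have hexp : ∀ u : Fin m → ℝ, Real.exp (-b * (u ⬝ᵥ u)) = ∏ i, Real.exp (-b * u i ^ 2) := by
    intro u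
    rw [← Real.exp_sum, dotProduct, Finset.mul_sum]
    simp only [pow_two]
  have hint : Integrable fun u : Fin m → ℝ => ∏ i, Real.exp (-b * u i ^ 2) :=
    Integrable.fintype_prod (f := fun _ x => Real.exp (-b * x ^ 2))
      fun _ => integrable_exp_neg_mul_sq hb
  simp only [hexp]
  rw [← ofReal_integral_eq_lintegral_ofReal hint
      (Filter.Eventually.of_forall fun u => Finset.prod_nonneg fun i _ => (Real.exp_pos _).le),
    integral_fintype_prod_volume_eq_pow (fun x : ℝ => Real.exp (-b * x ^ 2)),
    integral_gaussian, Fintype.card_fin, Real.sqrt_eq_rpow, ← Real.rpow_natCast,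
    ← Real.rpow_mul (by positivity)]
  congr 2
  ring

theorem lintegral_one_add_dotProduct_self_rpow (m : ℕ) {p : ℝ} (hp : (m : ℝ) / 2 < p) :
    ∫⁻ u : Fin m → ℝ, ENNReal.ofReal ((1 + u ⬝ᵥ u) ^ (-p)) =
      ENNReal.ofReal (π ^ ((m : ℝ) / 2) * Real.Gamma (p - m / 2) / Real.Gamma p) := by
  have hp0 : 0 < p := lt_of_le_of_lt (by positivity) hp
  have hΓ : 0 < Real.Gamma p := Real.Gamma_pos_of_pos hp0
  have hdot : ∀ u : Fin m → ℝ, 0 < 1 + u ⬝ᵥ u := fun u => by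
    have : 0 ≤ u ⬝ᵥ u := Finset.sum_nonneg fun i _ => mul_self_nonneg _
    linarith
  have hmul : ENNReal.ofReal (Real.Gamma p) *
      ∫⁻ u : Fin m → ℝ, ENNReal.ofReal ((1 + u ⬝ᵥ u) ^ (-p)) =
        ENNReal.ofReal (π ^ ((m : ℝ) / 2) * Real.Gamma (p - m / 2)) := by
    calc _ = ∫⁻ u : Fin m → ℝ, ∫⁻ t in Set.Ioi (0 : ℝ),
            ENNReal.ofReal (t ^ (p - 1) * Real.exp (-((1 + u ⬝ᵥ u) * t))) := by
          rw [← lintegral_const_mul' _ _ ENNReal.ofReal_ne_top]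
          refine lintegral_congr fun u => ?_
          rw [lintegral_rpow_mul_exp_neg_mul_Ioi hp0 (hdot u), ← ENNReal.ofReal_mul hΓ.le, mul_comm]
      _ = ∫⁻ t in Set.Ioi (0 : ℝ), ∫⁻ u : Fin m → ℝ,
            ENNReal.ofReal (t ^ (p - 1) * Real.exp (-((1 + u ⬝ᵥ u) * t))) := by
          refine lintegral_lintegral_swap (Measurable.aemeasurable ?_)
          simp only [Function.uncurry_def, dotProduct]
          fun_prop
      _ = ∫⁻ t in Set.Ioi (0 : ℝ), ENNReal.ofReal (π ^ ((m : ℝ) / 2)) *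
            ENNReal.ofReal (t ^ (p - m / 2 - 1) * Real.exp (-(1 * t))) := by
          refine setLIntegral_congr_fun measurableSet_Ioi fun t ht => ?_
          have ht : 0 < t := ht
          have hsplit : ∀ u : Fin m → ℝ,
              ENNReal.ofReal (t ^ (p - 1) * Real.exp (-((1 + u ⬝ᵥ u) * t))) =
                ENNReal.ofReal (t ^ (p - 1) * Real.exp (-t)) *
                  ENNReal.ofReal (Real.exp (-t * (u ⬝ᵥ u))) := by
            intro u
            rw [← ENNReal.ofReal_mul (by positivity), mul_assoc, ← Real.exp_add]
            congr 3
            ring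
          simp only [hsplit]
          rw [lintegral_const_mul' _ _ ENNReal.ofReal_ne_top,
            lintegral_exp_neg_mul_dotProduct_self m ht, ← ENNReal.ofReal_mul (by positivity),
            ← ENNReal.ofReal_mul (by positivity), Real.div_rpow (by positivity) ht.le,
            show p - m / 2 - 1 = (p - 1) - m / 2 by ring, Real.rpow_sub ht (p - 1), one_mul]
          congr 1
          ring
      _ = _ := by
          rw [lintegral_const_mul' _ _ ENNReal.ofReal_ne_top,
            lintegral_rpow_mul_exp_neg_mul_Ioi (by linarith) one_pos, Real.one_rpow, one_mul,
            ← ENNReal.ofReal_mul (by positivity)]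
  rw [ENNReal.ofReal_div_of_pos hΓ, ← hmul, mul_comm, ENNReal.mul_div_cancel_right]
  · simpa using hΓ
  · exact ENNReal.ofReal_ne_top

open scoped MatrixOrder ComplexOrder in
theorem Matrix.PosDef.exists_eq_mul_transpose {ι : Type*} [Fintype ι] [DecidableEq ι]
    {A : Matrix ι ι ℝ} (hA : A.PosDef) :
    ∃ L : Matrix ι ι ℝ, L.det ≠ 0 ∧ A = L * Lᵀ := by
  obtain ⟨B, hB⟩ := CStarAlgebra.nonneg_iff_eq_star_mul_self.mp hA.posSemidef.nonneg
  refine ⟨Bᵀ, fun h => hA.det_pos.ne' ?_, by simpa [star_eq_conjTranspose] using hB⟩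
  rw [hB, det_mul, ← det_transpose B, h, mul_zero]

theorem Matrix.PosDef.det_le_exp_trace {ι : Type*} [Fintype ι] [DecidableEq ι]
    {P : Matrix ι ι ℝ} (hP : P.PosDef) :
    P.det ≤ Real.exp (P.trace - Fintype.card ι) := by
  rw [hP.isHermitian.det_eq_prod_eigenvalues, hP.isHermitian.trace_eq_sum_eigenvalues]
  have hsum : (∑ i, ((hP.isHermitian.eigenvalues i : ℝ) : ℝ)) - Fintype.card ι =
      ∑ i, (hP.isHermitian.eigenvalues i - 1) := by
    simp [Finset.sum_sub_distrib]
  simp only [RCLike.ofReal_real_eq_id, id] at hsum ⊢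
  rw [hsum, Real.exp_sum]
  refine Finset.prod_le_prod (fun i _ => (hP.eigenvalues_pos i).le) fun i _ => ?_
  have := Real.add_one_le_exp (hP.isHermitian.eigenvalues i - 1)
  linarith

theorem Matrix.det_le_exp_trace_inv_mul {ι : Type*} [Fintype ι] [DecidableEq ι]
    {S T : Matrix ι ι ℝ} (hS : S.PosDef) (hT : T.PosDef) :
    T.det ≤ S.det * Real.exp ((S⁻¹ * T).trace - Fintype.card ι) := by
  obtain ⟨L, hL, rfl⟩ := hT.exists_eq_mul_transpose
  have hP : (Lᵀ * S⁻¹ * L).PosDef := by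
    have hinj : Function.Injective L.mulVec :=
      Matrix.mulVec_injective_of_isUnit ((Matrix.isUnit_iff_isUnit_det L).2 hL.isUnit)
    simpa using hS.inv.conjTranspose_mul_mul_same hinj
  have h := hP.det_le_exp_trace
  have htr : (Lᵀ * S⁻¹ * L).trace = (S⁻¹ * (L * Lᵀ)).trace := by
    rw [Matrix.mul_assoc, Matrix.trace_mul_comm, Matrix.mul_assoc]
  have hdet : (Lᵀ * S⁻¹ * L).det = S.det⁻¹ * (L * Lᵀ).det := by
    simp only [det_mul, det_transpose, det_nonsing_inv, Ring.inverse_eq_inv']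
    ring
  rw [htr, hdet] at h
  rwa [inv_mul_le_iff₀ hS.det_pos] at h

theorem Matrix.det_mul_transpose_add_smul_vecMulVec {ι : Type*} [Fintype ι] [DecidableEq ι]
    (L : Matrix ι ι ℝ) (t : ℝ) (u : ι → ℝ) :
    (L * Lᵀ + t • vecMulVec (L *ᵥ u) (L *ᵥ u)).det = (L * Lᵀ).det * (1 + t * (u ⬝ᵥ u)) := by
  have h : L * Lᵀ + t • vecMulVec (L *ᵥ u) (L *ᵥ u) =
      L * (1 + replicateCol Unit (t • u) * replicateRow Unit u) * Lᵀ := by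
    rw [← vecMulVec_eq, ← mul_vecMulVec, ← vecMul_transpose, ← vecMulVec_mul]
    simp [Matrix.mul_add, Matrix.add_mul, Matrix.mul_assoc, smul_vecMulVec]
  rw [h, det_mul, det_mul, det_one_add_replicateCol_mul_replicateRow, det_mul, dotProduct_smul,
    smul_eq_mul]
  ring

theorem Matrix.PosDef.add_smul_vecMulVec {ι : Type*} [Fintype ι]
    {A : Matrix ι ι ℝ} (hA : A.PosDef) {t : ℝ} (ht : 0 ≤ t) (v : ι → ℝ) :
    (A + t • vecMulVec v v).PosDef := by
  refine hA.add_posSemidef (Matrix.PosSemidef.smul ?_ ht)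
  simpa using Matrix.posSemidef_vecMulVec_self_star v

theorem lintegral_det_add_smul_vecMulVec_rpow {m : ℕ} {A : Matrix (Fin m) (Fin m) ℝ}
    (hA : A.PosDef) {t : ℝ} (ht : 0 < t) (a : Fin m → ℝ) {p : ℝ} (hp : (m : ℝ) / 2 < p) :
    ∫⁻ v : Fin m → ℝ, ENNReal.ofReal ((A + t • vecMulVec (v - a) (v - a)).det ^ (-p)) =
      ENNReal.ofReal (A.det ^ (1 / 2 - p) * t ^ (-((m : ℝ) / 2)) *
        (π ^ ((m : ℝ) / 2) * Real.Gamma (p - m / 2) / Real.Gamma p)) := by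
  rw [lintegral_sub_right_eq_self
    (fun v : Fin m → ℝ => ENNReal.ofReal ((A + t • vecMulVec v v).det ^ (-p))) a]
  have hdetA := hA.det_pos
  obtain ⟨L, hL, rfl⟩ := hA.exists_eq_mul_transpose
  set M : Matrix (Fin m) (Fin m) ℝ := (√t)⁻¹ • L with hM
  have hst : 0 < √t := Real.sqrt_pos.2 ht
  have hdetM : M.det = (√t)⁻¹ ^ m * L.det := by simp [hM]
  have hM0 : M.det ≠ 0 := by rw [hdetM]; positivity
  have habs : |M.det| = (L * Lᵀ).det ^ ((1 : ℝ) / 2) * t ^ (-((m : ℝ) / 2)) := by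
    rw [hdetM, abs_mul, abs_of_pos (by positivity : 0 < (√t)⁻¹ ^ m), det_mul, det_transpose,
      ← Real.sqrt_eq_rpow, Real.sqrt_mul_self_eq_abs, mul_comm, Real.sqrt_eq_rpow,
      ← Real.rpow_neg ht.le, ← Real.rpow_natCast, ← Real.rpow_mul ht.le]
    congr 2
    ring
  have hcov : (volume : Measure (Fin m → ℝ)) =
      ENNReal.ofReal |M.det| • Measure.map (toLin' M) volume := by
    rw [Real.map_matrix_volume_pi_eq_smul_volume_pi hM0, smul_smul,
      ← ENNReal.ofReal_mul (abs_nonneg _), ← abs_mul, mul_inv_cancel₀ hM0]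
    simp
  have hmeas : Measurable fun v : Fin m → ℝ =>
      ENNReal.ofReal ((L * Lᵀ + t • vecMulVec v v).det ^ (-p)) := by
    have : Continuous fun v : Fin m → ℝ => (L * Lᵀ + t • vecMulVec v v).det := by fun_prop
    exact (this.measurable.pow_const _).ennreal_ofReal
  rw [hcov, lintegral_smul_measure, lintegral_map hmeas (by
    exact (LinearMap.continuous_of_finiteDimensional _).measurable)]
  have hsubst : ∀ u : Fin m → ℝ,
      ENNReal.ofReal ((L * Lᵀ + t • vecMulVec (toLin' M u) (toLin' M u)).det ^ (-p)) =
        ENNReal.ofReal ((L * Lᵀ).det ^ (-p)) * ENNReal.ofReal ((1 + u ⬝ᵥ u) ^ (-p)) := by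
    intro u
    have hu : 0 ≤ u ⬝ᵥ u := Finset.sum_nonneg fun i _ => mul_self_nonneg _
    have hvec : t • vecMulVec (toLin' M u) (toLin' M u) =
        (1 : ℝ) • vecMulVec (L *ᵥ u) (L *ᵥ u) := by
      rw [toLin'_apply, hM, smul_mulVec, smul_vecMulVec, vecMulVec_smul, smul_smul, smul_smul]
      congr 1
      rw [mul_assoc, ← mul_inv, Real.mul_self_sqrt ht.le, mul_inv_cancel₀ ht.ne']
    rw [hvec, det_mul_transpose_add_smul_vecMulVec, one_mul,
      Real.mul_rpow hdetA.le (by linarith), ENNReal.ofReal_mul (by positivity)]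
  simp only [hsubst]
  rw [lintegral_const_mul' _ _ ENNReal.ofReal_ne_top,
    lintegral_one_add_dotProduct_self_rpow m hp, habs, smul_eq_mul,
    ← ENNReal.ofReal_mul (by positivity), ← ENNReal.ofReal_mul (by positivity),
    sub_eq_add_neg (1 / 2) p, Real.rpow_add hdetA]
  congr 1
  ring

/-- The scatter matrix of `y` about its shrunken mean `(∑ i, y i) / (c + n)`, added to a prior
scale matrix `A`. -/
noncomputable def shrunkenScatter {m n : ℕ} (c : ℝ) (A : Matrix (Fin m) (Fin m) ℝ)
    (y : Fin n → Fin m → ℝ) : Matrix (Fin m) (Fin m) ℝ :=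
  A + ∑ i, vecMulVec (y i) (y i) - (1 / (c + n)) • vecMulVec (∑ i, y i) (∑ i, y i)

theorem shrunkenScatter_cons {m n : ℕ} {c : ℝ} (hc : 0 < c) (A : Matrix (Fin m) (Fin m) ℝ)
    (v : Fin m → ℝ) (y : Fin n → Fin m → ℝ) :
    shrunkenScatter c A (Fin.cons v y : Fin (n + 1) → Fin m → ℝ) =
      shrunkenScatter c A y + ((c + n) / (c + n + 1)) •
        vecMulVec (v - (1 / (c + n)) • ∑ i, y i) (v - (1 / (c + n)) • ∑ i, y i) := by
  have h1 : c + n ≠ 0 := by positivity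
  have h2 : c + n + 1 ≠ 0 := by positivity
  simp only [shrunkenScatter, Fin.sum_univ_succ, Fin.cons_zero, Fin.cons_succ]
  generalize ∑ i, y i = s
  ext a b
  simp only [Matrix.add_apply, Matrix.sub_apply, Matrix.smul_apply, vecMulVec_apply, Pi.add_apply,
    Pi.sub_apply, Pi.smul_apply, smul_eq_mul]
  push_cast
  rw [← add_assoc c]
  field_simp
  ring

theorem shrunkenScatter_posDef {m : ℕ} {c : ℝ} (hc : 0 < c) {A : Matrix (Fin m) (Fin m) ℝ}
    (hA : A.PosDef) : ∀ {n : ℕ} (y : Fin n → Fin m → ℝ), (shrunkenScatter c A y).PosDef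
  | 0, y => by simpa [shrunkenScatter] using hA
  | n + 1, y => by
    rw [← Fin.cons_self_tail y, shrunkenScatter_cons hc]
    exact (shrunkenScatter_posDef hc hA _).add_smul_vecMulVec (by positivity) _

theorem measurable_det_shrunkenScatter_rpow {m n : ℕ} (c : ℝ) (A : Matrix (Fin m) (Fin m) ℝ)
    (p : ℝ) : Measurable fun y : Fin n → Fin m → ℝ => (shrunkenScatter c A y).det ^ p := by
  have : Continuous fun y : Fin n → Fin m → ℝ => (shrunkenScatter c A y).det := by
    unfold shrunkenScatter
    fun_prop
  exact this.measurable.pow_const _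

theorem multiGamma_mul_Gamma_add_half (m : ℕ) (z : ℝ) :
    multiGamma m z * Real.Gamma (z + 1 / 2) =
      multiGamma m (z + 1 / 2) * Real.Gamma (z + 1 / 2 - m / 2) := by
  have h : (∏ j : Fin m, Real.Gamma (z - (j : ℝ) / 2)) * Real.Gamma (z + 1 / 2) =
      (∏ j : Fin m, Real.Gamma (z + 1 / 2 - (j : ℝ) / 2)) * Real.Gamma (z + 1 / 2 - m / 2) := by
    rw [Fin.prod_univ_eq_prod_range (fun j : ℕ => Real.Gamma (z + 1 / 2 - (j : ℝ) / 2)),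
      Fin.prod_univ_eq_prod_range (fun j : ℕ => Real.Gamma (z - (j : ℝ) / 2)),
      ← Finset.prod_range_succ (fun j : ℕ => Real.Gamma (z + 1 / 2 - (j : ℝ) / 2)),
      Finset.prod_range_succ']
    congr 1
    · refine Finset.prod_congr rfl fun j _ => ?_
      congr 1
      push_cast
      ring
    · simp
  rw [multiGamma, multiGamma, mul_assoc, h, mul_assoc]

theorem multiGamma_pos {m : ℕ} {z : ℝ} (hz : ((m : ℝ) - 1) / 2 < z) : 0 < multiGamma m z := by
  refine mul_pos (by positivity) (Finset.prod_pos fun j _ => Real.Gamma_pos_of_pos ?_)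
  have : (j : ℝ) + 1 ≤ m := by exact_mod_cast j.2
  linarith

theorem lintegral_det_shrunkenScatter_rpow {m : ℕ} {c : ℝ} (hc : 0 < c)
    {A : Matrix (Fin m) (Fin m) ℝ} (hA : A.PosDef) {ν : ℝ} (hν : (m : ℝ) - 1 < ν) (hν0 : 0 < ν)
    (n : ℕ) :
    ∫⁻ y : Fin n → Fin m → ℝ,
        ENNReal.ofReal ((shrunkenScatter c A y).det ^ (-(((n : ℝ) + ν) / 2))) =
      ENNReal.ofReal (A.det ^ (-(ν / 2)) * ((c + n) / c) ^ ((m : ℝ) / 2) *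
        (π ^ ((n : ℝ) * m / 2) * multiGamma m (ν / 2) / multiGamma m ((n + ν) / 2))) := by
  have hΓ : ∀ k : ℕ, 0 < multiGamma m ((k + ν) / 2) := fun k => by
    refine multiGamma_pos ?_
    have : (0 : ℝ) ≤ k := k.cast_nonneg
    linarith
  induction n with
  | zero =>
    have h0 := hΓ 0
    simp only [Nat.cast_zero, zero_add] at h0
    rw [lintegral_unique]
    simp [shrunkenScatter, hc.ne', h0.ne', volume_pi]
  | succ n ih =>
    have hn1 : (0 : ℝ) < c + n := by positivity
    have hn2 : (0 : ℝ) < c + n + 1 := by positivity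
    set p : ℝ := ((n : ℝ) + 1 + ν) / 2 with hp_def
    have hp : (m : ℝ) / 2 < p := by
      have : (0 : ℝ) ≤ n := n.cast_nonneg
      rw [hp_def]; linarith
    have hmp := volume_preserving_piFinSuccAbove (fun _ : Fin (n + 1) => Fin m → ℝ) 0
    have hmeas : Measurable fun y : Fin (n + 1) → Fin m → ℝ =>
        ENNReal.ofReal ((shrunkenScatter c A y).det ^ (-p)) :=
      (measurable_det_shrunkenScatter_rpow c A _).ennreal_ofReal
    have hmeas' : Measurable fun z : (Fin m → ℝ) × (Fin n → Fin m → ℝ) =>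
        ENNReal.ofReal ((shrunkenScatter c A
          ((MeasurableEquiv.piFinSuccAbove (fun _ : Fin (n + 1) => Fin m → ℝ) 0).symm
            z)).det ^ (-p)) :=
      hmeas.comp (MeasurableEquiv.measurable _)
    have hgamma : Real.Gamma (p - m / 2) / Real.Gamma p =
        multiGamma m ((n + ν) / 2) / multiGamma m p := by
      have h := multiGamma_mul_Gamma_add_half m ((n + ν) / 2)
      rw [show ((n : ℝ) + ν) / 2 + 1 / 2 = p by rw [hp_def]; ring] at h
      have h1 : 0 < multiGamma m p := by
        have := hΓ (n + 1)
        push_cast at this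
        exact this
      have h2 : 0 < Real.Gamma p := Real.Gamma_pos_of_pos (by positivity)
      rw [div_eq_div_iff h2.ne' h1.ne', h]
      ring
    push_cast
    rw [← hp_def, ← hmp.symm.lintegral_comp hmeas, Measure.volume_eq_prod,
      lintegral_prod_symm' _ hmeas']
    have hinner : ∀ y : Fin n → Fin m → ℝ,
        ∫⁻ v : Fin m → ℝ, ENNReal.ofReal ((shrunkenScatter c A
          ((MeasurableEquiv.piFinSuccAbove (fun _ : Fin (n + 1) => Fin m → ℝ) 0).symm
            (v, y))).det ^ (-p)) =
        ENNReal.ofReal ((shrunkenScatter c A y).det ^ (-(((n : ℝ) + ν) / 2))) *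
          ENNReal.ofReal (((c + n) / (c + n + 1)) ^ (-((m : ℝ) / 2)) *
            (π ^ ((m : ℝ) / 2) * Real.Gamma (p - m / 2) / Real.Gamma p)) := by
      intro y
      have hpd := shrunkenScatter_posDef hc hA y
      have hcons : ∀ v : Fin m → ℝ,
          (MeasurableEquiv.piFinSuccAbove (fun _ : Fin (n + 1) => Fin m → ℝ) 0).symm (v, y) =
            (Fin.cons v y : Fin (n + 1) → Fin m → ℝ) := fun v => by
        simp [MeasurableEquiv.piFinSuccAbove, Fin.consEquiv]
      simp only [hcons, shrunkenScatter_cons hc]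
      rw [lintegral_det_add_smul_vecMulVec_rpow hpd (by positivity) _ hp,
        ← ENNReal.ofReal_mul (Real.rpow_nonneg hpd.det_pos.le _), mul_assoc]
      congr 3
      rw [hp_def]
      ring
    simp only [hinner]
    rw [lintegral_mul_const' _ _ ENNReal.ofReal_ne_top, ih, ← ENNReal.ofReal_mul (by
      have := hΓ n
      have := hΓ 0
      simp only [Nat.cast_zero, zero_add] at this
      have := hA.det_pos
      positivity), mul_div_assoc _ (Real.Gamma _), hgamma]
    congr 1
    rw [Real.rpow_neg (x := (c + n) / (c + n + 1)) (by positivity),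
      ← Real.inv_rpow (by positivity), inv_div,
      show ((n : ℝ) + 1) * m / 2 = n * m / 2 + m / 2 by ring, Real.rpow_add Real.pi_pos,
      show (c + ((n : ℝ) + 1)) / c = (c + n) / c * ((c + n + 1) / (c + n)) by
        field_simp; ring,
      Real.mul_rpow (by positivity) (by positivity)]
    have := (hΓ n).ne'
    field_simp

theorem sigmaBar2_eq_smul_shrunkenScatter {m n : ℕ} {ν ρ2 : ℝ} (hν : 0 < ν) (hρ : 0 < ρ2)
    (μ0 : Fin m → ℝ) (S0 : Matrix (Fin m) (Fin m) ℝ) (x : Fin n → Fin m → ℝ) :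
    sigmaBar2 m n ν ρ2 μ0 S0 x =
      (1 / (n + ν)) • shrunkenScatter (ρ2 * ν) (ν • S0) (fun i => x i - μ0) := by
  have hprod : ∑ i : Fin n, ∑ j : Fin n, vecMulVec (x i - μ0) (x j - μ0) =
      vecMulVec (∑ i, (x i - μ0)) (∑ i, (x i - μ0)) := by
    ext a b
    simp [Matrix.sum_apply, vecMulVec_apply, Finset.sum_apply, -Finset.sum_sub_distrib,
      Finset.sum_mul_sum]
  have h1 : (n : ℝ) + ν ≠ 0 := by positivity
  have h2 : ρ2 * ν + n ≠ 0 := by positivity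
  rw [sigmaBar2, shrunkenScatter, hprod, smul_sub, smul_smul, add_comm (ν • S0)]
  congr 2
  field_simp
  ring

theorem sum_vecMulVec_sub_add_smul {m n : ℕ} {ν ρ2 : ℝ} (hν : 0 < ν) (hρ : 0 < ρ2)
    (μ0 μ : Fin m → ℝ) (S0 : Matrix (Fin m) (Fin m) ℝ) (x : Fin n → Fin m → ℝ) :
    ∑ i, vecMulVec (x i - μ) (x i - μ) + ν • (S0 + ρ2 • vecMulVec (μ - μ0) (μ - μ0)) =
      ((n : ℝ) + ν) • sigmaBar2 m n ν ρ2 μ0 S0 x + ((n : ℝ) + ρ2 * ν) •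
        vecMulVec (μ - muBar2 m n ν ρ2 μ0 x) (μ - muBar2 m n ν ρ2 μ0 x) := by
  have h1 : (n : ℝ) + ν ≠ 0 := by positivity
  have h2 : ρ2 * ν + n ≠ 0 := by positivity
  have h3 : (n : ℝ) + ρ2 * ν ≠ 0 := by positivity
  rw [sigmaBar2_eq_smul_shrunkenScatter hν hρ, smul_smul, mul_one_div_cancel h1, one_smul,
    shrunkenScatter, muBar2, ← sub_sub]
  obtain ⟨y, hy⟩ : ∃ y : Fin n → Fin m → ℝ, ∀ i, x i - μ0 = y i := ⟨_, fun _ => rfl⟩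
  have hxy : ∀ i, x i - μ = y i - (μ - μ0) := fun i => by rw [← hy]; abel
  simp only [hxy, hy]
  generalize μ - μ0 = d
  ext a b
  simp only [Matrix.add_apply, Matrix.sub_apply, Matrix.smul_apply, vecMulVec_apply,
    Matrix.sum_apply, Finset.sum_apply, Pi.sub_apply, Pi.smul_apply, smul_eq_mul]
  have hexp : ∑ i, (y i a - d a) * (y i b - d b) =
      ∑ i, y i a * y i b - (∑ i, y i a) * d b - d a * ∑ i, y i b + n * (d a * d b) := by
    simp only [sub_mul, mul_sub, Finset.sum_sub_distrib, Finset.sum_mul, Finset.mul_sum,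
      Finset.sum_const, Finset.card_univ, Fintype.card_fin, nsmul_eq_mul]
    ring
  rw [hexp, add_comm (ρ2 * ν)]
  field_simp
  ring

theorem dotProduct_mulVec_eq_trace_mul_vecMulVec {ι : Type*} [Fintype ι]
    (M : Matrix ι ι ℝ) (v : ι → ℝ) : v ⬝ᵥ (M *ᵥ v) = (M * vecMulVec v v).trace := by
  rw [mul_vecMulVec, trace_vecMulVec, dotProduct_comm]

theorem mvnLik_mul_luck2 {m n : ℕ} {ν ρ2 : ℝ} (hν : 0 < ν) (hρ : 0 < ρ2)
    (μ0 μ : Fin m → ℝ) (S0 : Matrix (Fin m) (Fin m) ℝ) (x : Fin n → Fin m → ℝ)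
    {S : Matrix (Fin m) (Fin m) ℝ} (hS : S.PosDef) :
    mvnLik m n x μ S * luck2 m μ S ν μ0 S0 ρ2 =
      (2 * π) ^ (-(m * ((n + ν) / 2))) * S.det ^ (-((n + ν) / 2)) *
        Real.exp (-((n + ν) / 2 * (S⁻¹ * sigmaBar2 m n ν ρ2 μ0 S0 x).trace) -
          ((n : ℝ) + ρ2 * ν) / 2 * ((μ - muBar2 m n ν ρ2 μ0 x) ⬝ᵥ
            (S⁻¹ *ᵥ (μ - muBar2 m n ν ρ2 μ0 x)))) := by
  have hdet := hS.det_pos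
  have hpi : 0 < 2 * π := by positivity
  have htr := congrArg (fun M => (S⁻¹ * M).trace) (sum_vecMulVec_sub_add_smul hν hρ μ0 μ S0 x)
  simp only [Matrix.mul_add, Matrix.trace_add, Matrix.mul_smul, Matrix.trace_smul, smul_eq_mul,
    Matrix.mul_sum, Matrix.trace_sum] at htr
  rw [mvnLik, luck2, Finset.prod_mul_distrib, ← Real.exp_sum, Finset.prod_const,
    Finset.card_univ, Fintype.card_fin, mul_pow, ← Real.rpow_natCast, ← Real.rpow_natCast,
    ← Real.rpow_mul hpi.le, ← Real.rpow_mul hdet.le,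
    show -(m * ((n + ν) / 2)) = -(m : ℝ) / 2 * n + -(m : ℝ) * ν / 2 by ring,
    show -((n + ν) / 2) = -(1 : ℝ) / 2 * n + -ν / 2 by ring,
    Real.rpow_add hpi, Real.rpow_add hdet, mul_mul_mul_comm, ← Real.exp_add,
    mul_mul_mul_comm ((2 * π) ^ _)]
  congr 2
  simp only [dotProduct_mulVec_eq_trace_mul_vecMulVec, ← Finset.mul_sum, Matrix.mul_add,
    Matrix.trace_add, Matrix.mul_smul, Matrix.trace_smul, smul_eq_mul]
  linarith

theorem sigmaBar2_posDef {m n : ℕ} {ν ρ2 : ℝ} (hν : 0 < ν) (hρ : 0 < ρ2) (μ0 : Fin m → ℝ)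
    {S0 : Matrix (Fin m) (Fin m) ℝ} (hS0 : S0.PosDef) (x : Fin n → Fin m → ℝ) :
    (sigmaBar2 m n ν ρ2 μ0 S0 x).PosDef := by
  rw [sigmaBar2_eq_smul_shrunkenScatter hν hρ]
  exact (shrunkenScatter_posDef (by positivity) (hS0.smul hν) _).smul (by positivity)

theorem supLik2_eq {m n : ℕ} {ν ρ2 : ℝ} (hν : 0 < ν) (hρ : 0 < ρ2) (μ0 : Fin m → ℝ)
    {S0 : Matrix (Fin m) (Fin m) ℝ} (hS0 : S0.PosDef) (x : Fin n → Fin m → ℝ) :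
    supLik2 m n ν μ0 S0 ρ2 x = (2 * π) ^ (-(m * ((n + ν) / 2))) *
      (sigmaBar2 m n ν ρ2 μ0 S0 x).det ^ (-((n + ν) / 2)) *
        Real.exp (-((n + ν) / 2 * m)) := by
  have hT := sigmaBar2_posDef hν hρ μ0 hS0 x
  have hTdet := hT.det_pos
  have hle : ∀ p : (Fin m → ℝ) × {S : Matrix (Fin m) (Fin m) ℝ // S.PosDef},
      mvnLik m n x p.1 p.2.1 * luck2 m p.1 p.2.1 ν μ0 S0 ρ2 ≤
        (2 * π) ^ (-(m * ((n + ν) / 2))) *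
          (sigmaBar2 m n ν ρ2 μ0 S0 x).det ^ (-((n + ν) / 2)) *
            Real.exp (-((n + ν) / 2 * m)) := by
    rintro ⟨μ, S, hS⟩
    have hSdet := hS.det_pos
    rw [mvnLik_mul_luck2 hν hρ μ0 μ S0 x hS, mul_assoc, mul_assoc]
    refine mul_le_mul_of_nonneg_left ?_ (by positivity)
    have hquad : 0 ≤ (μ - muBar2 m n ν ρ2 μ0 x) ⬝ᵥ (S⁻¹ *ᵥ (μ - muBar2 m n ν ρ2 μ0 x)) := by
      simpa using hS.inv.posSemidef.dotProduct_mulVec_nonneg (μ - muBar2 m n ν ρ2 μ0 x)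
    have hdet := Real.rpow_le_rpow hTdet.le (det_le_exp_trace_inv_mul hS hT)
      (by positivity : 0 ≤ ((n : ℝ) + ν) / 2)
    rw [Real.mul_rpow hSdet.le (Real.exp_pos _).le, ← Real.exp_mul, Fintype.card_fin] at hdet
    rw [Real.rpow_neg hSdet.le, Real.rpow_neg hTdet.le, inv_mul_le_iff₀ (by positivity),
      mul_left_comm, le_inv_mul_iff₀ (by positivity)]
    refine (mul_le_mul_of_nonneg_right hdet (Real.exp_pos _).le).trans ?_
    rw [mul_assoc, ← Real.exp_add]
    refine mul_le_mul_of_nonneg_left (Real.exp_le_exp.2 ?_) (by positivity)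
    have : 0 ≤ ((n : ℝ) + ρ2 * ν) / 2 *
        ((μ - muBar2 m n ν ρ2 μ0 x) ⬝ᵥ (S⁻¹ *ᵥ (μ - muBar2 m n ν ρ2 μ0 x))) := by positivity
    linarith
  have : Nonempty ((Fin m → ℝ) × {S : Matrix (Fin m) (Fin m) ℝ // S.PosDef}) :=
    ⟨(0, ⟨S0, hS0⟩)⟩
  refine le_antisymm (ciSup_le hle) ?_
  refine le_of_eq_of_le ?_ (le_ciSup (f := fun p : (Fin m → ℝ) ×
    {S : Matrix (Fin m) (Fin m) ℝ // S.PosDef} =>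
      mvnLik m n x p.1 p.2.1 * luck2 m p.1 p.2.1 ν μ0 S0 ρ2)
    ⟨_, Set.forall_mem_range.2 hle⟩ (muBar2 m n ν ρ2 μ0 x, ⟨_, hT⟩))
  simp only [mvnLik_mul_luck2 hν hρ μ0 _ S0 x hT, sub_self, zero_dotProduct, mul_zero, sub_zero,
    Matrix.nonsing_inv_mul _ hTdet.ne'.isUnit, Matrix.trace_one, Fintype.card_fin]

theorem capC_pos {m n : ℕ} {ν σ2 ρ2 : ℝ} (hν : (m : ℝ) - 1 < ν) (hν0 : 0 < ν) (hσ : 0 < σ2)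
    (hρ : 0 < ρ2) : 0 < capC m n ν σ2 ρ2 := by
  have hn : (0 : ℝ) ≤ n := n.cast_nonneg
  have h1 : 0 < multiGamma m (ν / 2) := multiGamma_pos (by linarith)
  have h2 : 0 < multiGamma m ((n + ν) / 2) := multiGamma_pos (by linarith)
  rw [capC]
  positivity

theorem supLik2_div_capC {m n : ℕ} (hm : 1 ≤ m) {ν ρ2 : ℝ} (hν : (m : ℝ) - 1 < ν) (hν0 : 0 < ν)
    (hρ : 0 < ρ2) (μ0 : Fin m → ℝ) {S0 : Matrix (Fin m) (Fin m) ℝ} (hS0 : S0.PosDef)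
    (x : Fin n → Fin m → ℝ) :
    supLik2 m n ν μ0 S0 ρ2 x / capC m n ν (S0.det ^ ((1 : ℝ) / m)) ρ2 =
      (ν ^ ν / (π ^ (n : ℝ) * ((n : ℝ) + ν) ^ ((n : ℝ) + ν) *
          (1 + n / (ρ2 * ν)))) ^ ((m : ℝ) / 2) *
        (multiGamma m (((n : ℝ) + ν) / 2) / multiGamma m (ν / 2)) *
        (S0.det ^ (ν / 2) /
          (sigmaBar2 m n ν ρ2 μ0 S0 x).det ^ (((n : ℝ) + ν) / 2)) := by
  have hn : (0 : ℝ) ≤ n := n.cast_nonneg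
  have hm0 : (m : ℝ) ≠ 0 := by positivity
  have hdet := hS0.det_pos
  have hTdet := (sigmaBar2_posDef hν0 hρ μ0 hS0 x).det_pos
  have h1 : 0 < multiGamma m (ν / 2) := multiGamma_pos (by linarith)
  have h2 : 0 < multiGamma m ((n + ν) / 2) := multiGamma_pos (by linarith)
  rw [div_eq_iff (capC_pos hν hν0 (by positivity) hρ).ne', supLik2_eq hν0 hρ μ0 hS0, capC,
    ← Real.rpow_mul hdet.le, show (1 : ℝ) / m * (-(m : ℝ) * ν / 2) = -(ν / 2) by field_simp,
    Real.rpow_neg hdet.le, Real.rpow_neg hTdet.le]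
  have hconst : (2 * π) ^ (-(m * ((n + ν) / 2))) * Real.exp (-((n + ν) / 2 * m)) =
      (ν ^ ν / (π ^ (n : ℝ) * ((n : ℝ) + ν) ^ ((n : ℝ) + ν) *
          (1 + n / (ρ2 * ν)))) ^ ((m : ℝ) / 2) *
        ((((n : ℝ) + ν) ^ ((n : ℝ) + ν) * (1 + n / (ρ2 * ν))) /
          ((2 * Real.exp 1) ^ ((n : ℝ) + ν) * (π * ν) ^ ν)) ^ ((m : ℝ) / 2) := by
    rw [← Real.mul_rpow (by positivity) (by positivity),
      show (2 * π) ^ (-(m * ((n + ν) / 2))) = ((2 * π) ^ (-(n + ν))) ^ ((m : ℝ) / 2) by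
        rw [← Real.rpow_mul (by positivity)]; ring_nf,
      show Real.exp (-((n + ν) / 2 * m)) = (Real.exp (-(n + ν))) ^ ((m : ℝ) / 2) by
        rw [← Real.exp_mul]; ring_nf,
      ← Real.mul_rpow (by positivity) (by positivity)]
    congr 1
    rw [Real.rpow_neg (by positivity), Real.exp_neg, Real.mul_rpow (by positivity) (by positivity),
      Real.mul_rpow (by positivity) (by positivity), Real.mul_rpow (by positivity) (by positivity),
      Real.exp_one_rpow, Real.rpow_add Real.pi_pos]
    field_simp
  calc _ = ((2 * π) ^ (-(m * ((n + ν) / 2))) * Real.exp (-((n + ν) / 2 * m))) *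
        ((sigmaBar2 m n ν ρ2 μ0 S0 x).det ^ ((n + ν) / 2))⁻¹ := by ring
    _ = _ := by
      rw [hconst]
      field_simp

theorem lintegral_det_sigmaBar2_rpow {m n : ℕ} {ν ρ2 : ℝ} (hν : (m : ℝ) - 1 < ν) (hν0 : 0 < ν)
    (hρ : 0 < ρ2) (μ0 : Fin m → ℝ) {S0 : Matrix (Fin m) (Fin m) ℝ} (hS0 : S0.PosDef) :
    ∫⁻ x : Fin n → Fin m → ℝ,
        ENNReal.ofReal ((sigmaBar2 m n ν ρ2 μ0 S0 x).det ^ (-(((n : ℝ) + ν) / 2))) =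
      ENNReal.ofReal (((n + ν) ^ (n + ν)) ^ ((m : ℝ) / 2) *
        ((ν • S0).det ^ (-(ν / 2)) * ((ρ2 * ν + n) / (ρ2 * ν)) ^ ((m : ℝ) / 2) *
          (π ^ ((n : ℝ) * m / 2) * multiGamma m (ν / 2) / multiGamma m ((n + ν) / 2)))) := by
  have hc : 0 < ρ2 * ν := by positivity
  have hN : 0 < (n : ℝ) + ν := by positivity
  have hA : (ν • S0).PosDef := hS0.smul hν0
  have hscale : ∀ x : Fin n → Fin m → ℝ,
      ENNReal.ofReal ((sigmaBar2 m n ν ρ2 μ0 S0 x).det ^ (-(((n : ℝ) + ν) / 2))) =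
        ENNReal.ofReal (((n + ν) ^ (n + ν)) ^ ((m : ℝ) / 2)) *
          ENNReal.ofReal ((shrunkenScatter (ρ2 * ν) (ν • S0) (x - fun _ => μ0)).det ^
            (-(((n : ℝ) + ν) / 2))) := by
    intro x
    have hpos := (shrunkenScatter_posDef hc hA (fun i => x i - μ0)).det_pos
    rw [sigmaBar2_eq_smul_shrunkenScatter hν0 hρ, det_smul, Fintype.card_fin,
      Real.mul_rpow (by positivity) hpos.le, ENNReal.ofReal_mul (by positivity)]
    congr 2
    rw [one_div, inv_pow, Real.rpow_neg (by positivity), Real.inv_rpow (by positivity), inv_inv,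
      ← Real.rpow_natCast, ← Real.rpow_mul hN.le, ← Real.rpow_mul hN.le]
    congr 1
    ring
  simp only [hscale]
  rw [lintegral_const_mul' _ _ ENNReal.ofReal_ne_top,
    lintegral_sub_right_eq_self (fun y : Fin n → Fin m → ℝ =>
      ENNReal.ofReal ((shrunkenScatter (ρ2 * ν) (ν • S0) y).det ^ (-(((n : ℝ) + ν) / 2)))),
    lintegral_det_shrunkenScatter_rpow hc hA hν hν0, ← ENNReal.ofReal_mul (by positivity)]

/-- Theorem 2, LNML density: the closed form of the LNML density
for the generalized luckiness, and the fact that it integrates to one. -/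
theorem lnml_density_generalized (m n : ℕ) (hm : 1 ≤ m) (hn : 1 ≤ n) (ν ρ2 : ℝ)
    (hν : (m : ℝ) - 1 < ν) (hρ : 0 < ρ2)
    (μ0 : Fin m → ℝ) (S0 : Matrix (Fin m) (Fin m) ℝ) (hS0 : S0.PosDef) :
    (∀ x : Fin n → Fin m → ℝ,
        supLik2 m n ν μ0 S0 ρ2 x / capC m n ν (S0.det ^ ((1 : ℝ) / m)) ρ2 =
          (ν ^ ν / (π ^ (n : ℝ) * ((n : ℝ) + ν) ^ ((n : ℝ) + ν) *
              (1 + n / (ρ2 * ν)))) ^ ((m : ℝ) / 2) *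
            (multiGamma m (((n : ℝ) + ν) / 2) / multiGamma m (ν / 2)) *
            (S0.det ^ (ν / 2) /
              (sigmaBar2 m n ν ρ2 μ0 S0 x).det ^ (((n : ℝ) + ν) / 2)))
    ∧ ∫ x : Fin n → Fin m → ℝ,
        supLik2 m n ν μ0 S0 ρ2 x / capC m n ν (S0.det ^ ((1 : ℝ) / m)) ρ2 = 1 := by
  have hν0 : 0 < ν := by
    have : (1 : ℝ) ≤ m := by exact_mod_cast hm
    linarith
  have hform := supLik2_div_capC (n := n) hm hν hν0 hρ μ0 hS0
  refine ⟨hform, ?_⟩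
  have hn : (0 : ℝ) ≤ n := n.cast_nonneg
  have h1 : 0 < multiGamma m (ν / 2) := multiGamma_pos (by linarith)
  have h2 : 0 < multiGamma m ((n + ν) / 2) := multiGamma_pos (by linarith)
  have hdet := hS0.det_pos
  have hTdet : ∀ x : Fin n → Fin m → ℝ, 0 < (sigmaBar2 m n ν ρ2 μ0 S0 x).det :=
    fun x => (sigmaBar2_posDef hν0 hρ μ0 hS0 x).det_pos
  have hmeas : Measurable fun x : Fin n → Fin m → ℝ =>
      (sigmaBar2 m n ν ρ2 μ0 S0 x).det ^ (-(((n : ℝ) + ν) / 2)) := by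
    have : Continuous fun x : Fin n → Fin m → ℝ => (sigmaBar2 m n ν ρ2 μ0 S0 x).det := by
      unfold sigmaBar2
      fun_prop
    exact this.measurable.pow_const _
  simp only [hform, div_eq_mul_inv (S0.det ^ (ν / 2)), ← Real.rpow_neg (hTdet _).le,
    integral_const_mul]
  rw [integral_eq_lintegral_of_nonneg_ae
      (Filter.Eventually.of_forall fun x => Real.rpow_nonneg (hTdet x).le _)
      hmeas.aestronglyMeasurable,
    lintegral_det_sigmaBar2_rpow hν hν0 hρ μ0 hS0, det_smul, Fintype.card_fin,
    ENNReal.toReal_ofReal (by positivity), Real.mul_rpow (by positivity) hdet.le,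
    Real.rpow_neg (by positivity), Real.rpow_neg hdet.le, ← Real.rpow_natCast,
    ← Real.rpow_mul hν0.le, Real.div_rpow (by positivity) (by positivity),
    Real.mul_rpow (by positivity) (by positivity), Real.mul_rpow (by positivity) (by positivity),
    show ((ρ2 * ν + n) / (ρ2 * ν)) = 1 + n / (ρ2 * ν) by field_simp,
    ← Real.rpow_mul hν0.le, ← Real.rpow_mul Real.pi_pos.le,
    show ν * ((m : ℝ) / 2) = m * (ν / 2) by ring,
    show (n : ℝ) * ((m : ℝ) / 2) = n * m / 2 by ring]
  have h3 : 0 < (1 + n / (ρ2 * ν)) ^ ((m : ℝ) / 2) := by positivity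
  generalize (1 + n / (ρ2 * ν)) ^ ((m : ℝ) / 2) = z at h3 ⊢
  field_simp
end

section
/- (Theorem 2, maximizer.) Fix integers m ≥ 1, n ≥ 1, reals ν > m−1, ρ² > 0, a vector μ₀ ∈ ℝ^m and a positive definite matrix Σ₀ ∈ ℝ^{m×m}. For every x^n = (x_1,…,x_n) ∈ (ℝ^m)^n, the supremum over μ ∈ ℝ^m and positive definite Σ of f(x^n;μ,Σ)·π(μ,Σ;ν,μ₀,Σ₀,ρ²) is attained at μ̄_n = μ₀ + (1/(n+ρ²ν))·Σ_{i=1}^n (x_i−μ₀) and Σ̄_n = (1/(n+ν))·(Σ_{i=1}^n (x_i−μ₀)(x_i−μ₀)ᵀ + νΣ₀) − (1/((ν+n)(ρ²ν+n)))·Σ_{i,j=1}^n (x_i−μ₀)(x_j−μ₀)ᵀ. -/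
open MeasureTheory Matrix Real BigOperators

/-- A real positive semidefinite matrix satisfies `det A ≤ exp (tr A - m)`. -/
theorem Matrix.PosSemidef.det_le_exp_trace_sub_card {ι : Type*} [Fintype ι] [DecidableEq ι]
    {A : Matrix ι ι ℝ} (hA : A.PosSemidef) :
    A.det ≤ Real.exp (A.trace - Fintype.card ι) := by
  have hdet := hA.isHermitian.det_eq_prod_eigenvalues
  have htr := hA.isHermitian.trace_eq_sum_eigenvalues
  simp only [RCLike.ofReal_real_eq_id, id] at hdet htr
  have hexp : A.trace - Fintype.card ι = ∑ i, (hA.isHermitian.eigenvalues i - 1) := by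
    simp [htr, Finset.sum_sub_distrib]
  rw [hdet, hexp, Real.exp_sum]
  refine Finset.prod_le_prod (fun i _ => hA.eigenvalues_nonneg i) fun i _ => ?_
  linarith [Real.add_one_le_exp (hA.isHermitian.eigenvalues i - 1)]

open scoped MatrixOrder in
theorem Matrix.PosDef.det_le_det_mul_exp_trace {ι : Type*} [Fintype ι] [DecidableEq ι]
    {S T : Matrix ι ι ℝ} (hS : S.PosDef) (hT : T.PosSemidef) :
    T.det ≤ S.det * Real.exp ((S⁻¹ * T).trace - Fintype.card ι) := by
  obtain ⟨B, hB⟩ := CStarAlgebra.nonneg_iff_eq_star_mul_self.mp hS.inv.posSemidef.nonneg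
  rw [Matrix.star_eq_conjTranspose] at hB
  have h := (hT.mul_mul_conjTranspose_same B).det_le_exp_trace_sub_card
  have htr : (B * T * Bᴴ).trace = (S⁻¹ * T).trace := by
    rw [Matrix.trace_mul_comm, ← Matrix.mul_assoc, hB]
  have hdet : S.det * (B * T * Bᴴ).det = T.det := by
    have h1 : (B * T * Bᴴ).det = (S⁻¹).det * T.det := by
      rw [hB]; simp only [Matrix.det_mul]; ring
    rw [h1, ← mul_assoc, ← Matrix.det_mul,
      Matrix.mul_nonsing_inv _ (isUnit_iff_ne_zero.mpr hS.det_pos.ne'), Matrix.det_one, one_mul]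
  rw [htr] at h
  rw [← hdet]
  exact mul_le_mul_of_nonneg_left h hS.det_pos.le

/-- The Wishart-type functional `S ↦ det S ^ (-N/2) * exp (-(N/2) * tr (S⁻¹ T))` is maximal
at `S = T`. -/
theorem det_rpow_mul_exp_trace_le {ι : Type*} [Fintype ι] [DecidableEq ι]
    {S T : Matrix ι ι ℝ} (hS : S.PosDef) (hT : T.PosDef) {N : ℝ} (hN : 0 ≤ N) :
    S.det ^ (-N / 2) * Real.exp (-(N / 2) * (S⁻¹ * T).trace) ≤
      T.det ^ (-N / 2) * Real.exp (-(N / 2) * (T⁻¹ * T).trace) := by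
  have h := Real.log_le_log hT.det_pos (hS.det_le_det_mul_exp_trace hT.posSemidef)
  rw [Real.log_mul hS.det_pos.ne' (Real.exp_ne_zero _), Real.log_exp] at h
  rw [Matrix.nonsing_inv_mul _ (isUnit_iff_ne_zero.mpr hT.det_pos.ne'), Matrix.trace_one,
    Real.rpow_def_of_pos hS.det_pos, Real.rpow_def_of_pos hT.det_pos, ← Real.exp_add,
    ← Real.exp_add, Real.exp_le_exp]
  nlinarith

theorem Matrix.trace_mul_vecMulVec_self {ι R : Type*} [Fintype ι] [CommSemiring R]
    (A : Matrix ι ι R) (v : ι → R) : (A * vecMulVec v v).trace = v ⬝ᵥ (A *ᵥ v) := by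
  rw [Matrix.mul_vecMulVec, Matrix.trace_vecMulVec, dotProduct_comm]

theorem Matrix.posSemidef_vecMulVec_self_real {ι : Type*} [Fintype ι] (v : ι → ℝ) :
    (vecMulVec v v).PosSemidef := by
  simpa using Matrix.posSemidef_vecMulVec_self_star v

/-- The matrix paired with `S⁻¹` in the exponent of likelihood times generalized luckiness. -/
noncomputable def scatter (m n : ℕ) (ν ρ2 : ℝ) (μ0 : Fin m → ℝ) (S0 : Matrix (Fin m) (Fin m) ℝ)
    (x : Fin n → Fin m → ℝ) (μ : Fin m → ℝ) : Matrix (Fin m) (Fin m) ℝ :=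
  ∑ i, vecMulVec (x i - μ) (x i - μ) + ν • (S0 + ρ2 • vecMulVec (μ - μ0) (μ - μ0))

theorem mvnLik_mul_luck2_eq {m n : ℕ} (ν ρ2 : ℝ) (μ0 : Fin m → ℝ)
    (S0 : Matrix (Fin m) (Fin m) ℝ) (x : Fin n → Fin m → ℝ) (μ : Fin m → ℝ)
    {S : Matrix (Fin m) (Fin m) ℝ} (hS : S.PosDef) :
    mvnLik m n x μ S * luck2 m μ S ν μ0 S0 ρ2 =
      ((2 * π) ^ (-(m : ℝ) / 2)) ^ n * (2 * π) ^ (-(m : ℝ) * ν / 2) *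
        (S.det ^ (-(n + ν) / 2) *
          Real.exp (-(1 / 2) * (S⁻¹ * scatter m n ν ρ2 μ0 S0 x μ).trace)) := by
  have hdet : S.det ^ (-(n + ν) / 2) = (S.det ^ (-(1 : ℝ) / 2)) ^ n * S.det ^ (-ν / 2) := by
    rw [← Real.rpow_natCast, ← Real.rpow_mul hS.det_pos.le, ← Real.rpow_add hS.det_pos]
    ring_nf
  have htr : -(1 / 2) * (S⁻¹ * scatter m n ν ρ2 μ0 S0 x μ).trace =
      ∑ i, -(1 / 2) * ((x i - μ) ⬝ᵥ (S⁻¹ *ᵥ (x i - μ))) +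
        -(ν / 2) * (S⁻¹ * (S0 + ρ2 • vecMulVec (μ - μ0) (μ - μ0))).trace := by
    rw [scatter, Matrix.mul_add, Matrix.mul_sum, Matrix.trace_add, Matrix.trace_sum,
      Matrix.mul_smul, Matrix.trace_smul, ← Finset.mul_sum]
    simp only [Matrix.trace_mul_vecMulVec_self, smul_eq_mul]
    ring
  rw [hdet, htr, Real.exp_add, Real.exp_sum, mvnLik, luck2]
  simp only [Finset.prod_mul_distrib, Finset.prod_const, Finset.card_univ, Fintype.card_fin]
  ring

/-- Completing the square in `μ`. -/
theorem scatter_eq {m n : ℕ} {ν ρ2 : ℝ} (hN : (n : ℝ) + ν ≠ 0) (hc : (n : ℝ) + ρ2 * ν ≠ 0)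
    (μ0 : Fin m → ℝ) (S0 : Matrix (Fin m) (Fin m) ℝ) (x : Fin n → Fin m → ℝ) (μ : Fin m → ℝ) :
    scatter m n ν ρ2 μ0 S0 x μ = (n + ν) • sigmaBar2 m n ν ρ2 μ0 S0 x +
      (n + ρ2 * ν) • vecMulVec (μ - muBar2 m n ν ρ2 μ0 x) (μ - muBar2 m n ν ρ2 μ0 x) := by
  ext a b
  have hL : ∑ i, (x i a - μ a) * (x i b - μ b) = ∑ i, (x i a - μ0 a) * (x i b - μ0 b)
      - (∑ i, (x i a - μ0 a)) * (μ b - μ0 b) - (μ a - μ0 a) * (∑ i, (x i b - μ0 b))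
      + n * ((μ a - μ0 a) * (μ b - μ0 b)) := by
    have : (n : ℝ) * ((μ a - μ0 a) * (μ b - μ0 b)) =
        ∑ _i : Fin n, (μ a - μ0 a) * (μ b - μ0 b) := by simp
    rw [this, Finset.sum_mul, Finset.mul_sum, ← Finset.sum_sub_distrib,
      ← Finset.sum_sub_distrib, ← Finset.sum_add_distrib]
    exact Finset.sum_congr rfl fun i _ => by ring
  simp only [scatter, sigmaBar2, muBar2, Matrix.add_apply, Matrix.sub_apply, Matrix.smul_apply,
    Matrix.sum_apply, vecMulVec_apply, Pi.sub_apply, Pi.add_apply, Pi.smul_apply,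
    Finset.sum_apply, smul_eq_mul, hL]
  rw [← Finset.sum_mul_sum, add_comm ν, add_comm (ρ2 * ν)]
  generalize ∑ i, (x i a - μ0 a) * (x i b - μ0 b) = q
  generalize ∑ i, (x i a - μ0 a) = s
  generalize ∑ i, (x i b - μ0 b) = t
  obtain ⟨c, hceq⟩ : ∃ c, c = (n : ℝ) + ρ2 * ν := ⟨_, rfl⟩
  rw [← hceq] at hc ⊢
  field_simp
  rw [hceq]
  ring

/-- Theorem 2, maximizer: the supremum of likelihood times
generalized luckiness is attained at the MAP estimates. -/
theorem lnml_sup_attained_generalized (m n : ℕ) (hm : 1 ≤ m) (hn : 1 ≤ n) (ν ρ2 : ℝ)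
    (hν : (m : ℝ) - 1 < ν) (hρ : 0 < ρ2)
    (μ0 : Fin m → ℝ) (S0 : Matrix (Fin m) (Fin m) ℝ) (hS0 : S0.PosDef)
    (x : Fin n → Fin m → ℝ) (μ : Fin m → ℝ) (S : Matrix (Fin m) (Fin m) ℝ)
    (hS : S.PosDef) :
    mvnLik m n x μ S * luck2 m μ S ν μ0 S0 ρ2 ≤
      mvnLik m n x (muBar2 m n ν ρ2 μ0 x) (sigmaBar2 m n ν ρ2 μ0 S0 x) *
        luck2 m (muBar2 m n ν ρ2 μ0 x) (sigmaBar2 m n ν ρ2 μ0 S0 x) ν μ0 S0 ρ2 := by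
  have hν0 : 0 < ν := by
    have : (1 : ℝ) ≤ m := by exact_mod_cast hm
    linarith
  have hN : 0 < (n : ℝ) + ν := by positivity
  have hc : 0 < (n : ℝ) + ρ2 * ν := by positivity
  have hT := sigmaBar2_posDef hν0 hρ μ0 hS0 x
  rw [mvnLik_mul_luck2_eq ν ρ2 μ0 S0 x μ hS, mvnLik_mul_luck2_eq ν ρ2 μ0 S0 x _ hT,
    scatter_eq hN.ne' hc.ne', scatter_eq hN.ne' hc.ne', sub_self, Matrix.vecMulVec_zero,
    smul_zero, add_zero]
  set T := sigmaBar2 m n ν ρ2 μ0 S0 x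
  set d := μ - muBar2 m n ν ρ2 μ0 x
  have hd : 0 ≤ d ⬝ᵥ (S⁻¹ *ᵥ d) := by
    simpa using hS.inv.posSemidef.dotProduct_mulVec_nonneg d
  have htr : (S⁻¹ * (((n : ℝ) + ν) • T + ((n : ℝ) + ρ2 * ν) • vecMulVec d d)).trace =
      (n + ν) * (S⁻¹ * T).trace + (n + ρ2 * ν) * (d ⬝ᵥ (S⁻¹ *ᵥ d)) := by
    simp only [Matrix.mul_add, Matrix.mul_smul, Matrix.trace_add, Matrix.trace_smul,
      Matrix.trace_mul_vecMulVec_self, smul_eq_mul]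
  gcongr ?_ * ?_
  calc _ ≤ S.det ^ (-(n + ν) / 2) * Real.exp (-((n + ν) / 2) * (S⁻¹ * T).trace) := by
        refine mul_le_mul_of_nonneg_left (Real.exp_le_exp.mpr ?_)
          (Real.rpow_nonneg hS.det_pos.le _)
        rw [htr]
        linarith [mul_nonneg hc.le hd]
    _ ≤ T.det ^ (-(n + ν) / 2) * Real.exp (-((n + ν) / 2) * (T⁻¹ * T).trace) :=
        det_rpow_mul_exp_trace_le hS hT hN.le
    _ = _ := by
        rw [Matrix.mul_smul, Matrix.trace_smul, smul_eq_mul]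
        ring_nf
end
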